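/- arXiv:1901.01530 — 2 statements merged into one kernel-verified Lean document; each statement's English description precedes it below -/
import Mathlib

section
/- Let v = (v₁,v₂,v₃) ∈ ℝ³, define φ_v(s,θ) = v₁·cos(θ)/cosh(s) + v₂·sin(θ)/cosh(s) − v₃·tanh(s), and define ψ_v(s,θ) = a²·(v₁·cosh(s)cos(θ) + v₂·cosh(s)sin(θ) + v₃·s)·(1 − s·tanh(s)) + (1/2)·(1 − a²·(cosh(s)² + s²))·φ_v(s,θ). Then for every smooth function w on [−T,T]×ℝ, 2π-periodic in θ, one has B(φ_v, w) = −2·a²·∫₀^{2π}∫_{−T}^{T} cosh(s)²·φ_v·w ds dθ + ∫₀^{2π}∫_{−T}^{T} (−∂²w/∂s² − ∂²w/∂θ² − 2·cosh(s)^{-2}·w)·ψ_v ds dθ. -/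
/-- The index form of the critical catenoid, for `2π`-periodic functions on `[-T,T] × ℝ`. -/
noncomputable def indexForm (T : ℝ) (u w : ℝ → ℝ → ℝ) : ℝ :=
  (∫ θ in (0:ℝ)..(2 * Real.pi), ∫ s in (-T)..T,
      (deriv (fun s' => u s' θ) s * deriv (fun s' => w s' θ) s
        + deriv (fun θ' => u s θ') θ * deriv (fun θ' => w s θ') θ
        - 2 / (Real.cosh s) ^ 2 * u s θ * w s θ))
  - (1 / T) * ∫ θ in (0:ℝ)..(2 * Real.pi),
      (u T θ * w T θ + u (-T) θ * w (-T) θ)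

/-- The normal component `v·N` of a constant vector `v ∈ ℝ³` along the critical catenoid. -/
noncomputable def phiV (v₁ v₂ v₃ : ℝ) : ℝ → ℝ → ℝ :=
  fun s θ => v₁ * Real.cos θ / Real.cosh s + v₂ * Real.sin θ / Real.cosh s
    - v₃ * Real.tanh s

/-- The normal component of the vector field `Y = (v,x)x + (1/2)(1-|x|²)v`
along the critical catenoid. -/
noncomputable def psiV (a v₁ v₂ v₃ : ℝ) : ℝ → ℝ → ℝ :=
  fun s θ =>
    a ^ 2 * (v₁ * Real.cosh s * Real.cos θ + v₂ * Real.cosh s * Real.sin θ + v₃ * s)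
        * (1 - s * Real.tanh s)
      + (1 / 2) * (1 - a ^ 2 * ((Real.cosh s) ^ 2 + s ^ 2)) * phiV v₁ v₂ v₃ s θ

section

open Real Set MeasureTheory

/-- The partial derivative in the first variable. -/
noncomputable def partialFst (w : ℝ → ℝ → ℝ) : ℝ → ℝ → ℝ :=
  fun s θ => deriv (fun s' => w s' θ) s

/-- The partial derivative in the second variable. -/
noncomputable def partialSnd (w : ℝ → ℝ → ℝ) : ℝ → ℝ → ℝ :=
  fun s θ => deriv (fun θ' => w s θ') θ

/-- The Laplacian on the plane. -/
noncomputable def planeLaplacian (w : ℝ → ℝ → ℝ) : ℝ → ℝ → ℝ :=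
  fun s θ => partialFst (partialFst w) s θ + partialSnd (partialSnd w) s θ

theorem iteratedDeriv_two_fst (w : ℝ → ℝ → ℝ) (s θ : ℝ) :
    iteratedDeriv 2 (fun s' => w s' θ) s = partialFst (partialFst w) s θ := by
  rw [iteratedDeriv_succ, iteratedDeriv_one]; rfl

theorem iteratedDeriv_two_snd (w : ℝ → ℝ → ℝ) (s θ : ℝ) :
    iteratedDeriv 2 (fun θ' => w s θ') θ = partialSnd (partialSnd w) s θ := by
  rw [iteratedDeriv_succ, iteratedDeriv_one]; rfl

theorem hasDerivAt_fst_fderiv {w : ℝ → ℝ → ℝ} {p : ℝ × ℝ}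
    (hw : DifferentiableAt ℝ (Function.uncurry w) p) :
    HasDerivAt (fun s => w s p.2) (fderiv ℝ (Function.uncurry w) p (1, 0)) p.1 :=
  HasFDerivAt.comp_hasDerivAt (f := fun s => (s, p.2)) p.1 hw.hasFDerivAt
    ((hasDerivAt_id p.1).prodMk (hasDerivAt_const p.1 p.2))

theorem hasDerivAt_snd_fderiv {w : ℝ → ℝ → ℝ} {p : ℝ × ℝ}
    (hw : DifferentiableAt ℝ (Function.uncurry w) p) :
    HasDerivAt (fun θ => w p.1 θ) (fderiv ℝ (Function.uncurry w) p (0, 1)) p.2 :=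
  HasFDerivAt.comp_hasDerivAt (f := fun θ => (p.1, θ)) p.2 hw.hasFDerivAt
    ((hasDerivAt_const p.2 p.1).prodMk (hasDerivAt_id p.2))

theorem hasDerivAt_partialFst {w : ℝ → ℝ → ℝ}
    (hw : ContDiff ℝ (⊤ : ℕ∞) (Function.uncurry w)) (s θ : ℝ) :
    HasDerivAt (fun s' => w s' θ) (partialFst w s θ) s :=
  (hasDerivAt_fst_fderiv (p := (s, θ))
    (hw.differentiable (by simp) (s, θ))).differentiableAt.hasDerivAt

theorem hasDerivAt_partialSnd {w : ℝ → ℝ → ℝ}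
    (hw : ContDiff ℝ (⊤ : ℕ∞) (Function.uncurry w)) (s θ : ℝ) :
    HasDerivAt (fun θ' => w s θ') (partialSnd w s θ) θ :=
  (hasDerivAt_snd_fderiv (p := (s, θ))
    (hw.differentiable (by simp) (s, θ))).differentiableAt.hasDerivAt

theorem contDiff_partialFst {w : ℝ → ℝ → ℝ}
    (hw : ContDiff ℝ (⊤ : ℕ∞) (Function.uncurry w)) :
    ContDiff ℝ (⊤ : ℕ∞) (Function.uncurry (partialFst w)) := by
  have h : Function.uncurry (partialFst w) =
      fun p => fderiv ℝ (Function.uncurry w) p (1, 0) :=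
    funext fun p => (hasDerivAt_fst_fderiv (hw.differentiable (by simp) p)).deriv
  rw [h]
  exact (hw.fderiv_right (by simp)).clm_apply contDiff_const

theorem contDiff_partialSnd {w : ℝ → ℝ → ℝ}
    (hw : ContDiff ℝ (⊤ : ℕ∞) (Function.uncurry w)) :
    ContDiff ℝ (⊤ : ℕ∞) (Function.uncurry (partialSnd w)) := by
  have h : Function.uncurry (partialSnd w) =
      fun p => fderiv ℝ (Function.uncurry w) p (0, 1) :=
    funext fun p => (hasDerivAt_snd_fderiv (hw.differentiable (by simp) p)).deriv
  rw [h]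
  exact (hw.fderiv_right (by simp)).clm_apply contDiff_const

theorem continuous_planeLaplacian {w : ℝ → ℝ → ℝ}
    (hw : ContDiff ℝ (⊤ : ℕ∞) (Function.uncurry w)) :
    Continuous (Function.uncurry (planeLaplacian w)) :=
  (contDiff_partialFst (contDiff_partialFst hw)).continuous.add
    (contDiff_partialSnd (contDiff_partialSnd hw)).continuous

theorem partialSnd_add_period {w : ℝ → ℝ → ℝ} {c : ℝ} (hw : ∀ s θ, w s (θ + c) = w s θ)
    (s θ : ℝ) : partialSnd w s (θ + c) = partialSnd w s θ := by
  unfold partialSnd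
  rw [← deriv_comp_add_const]
  simp only [hw]

/-- The divergence theorem on a rectangle for fields that are periodic in the second variable. -/
theorem integral_divergence_of_periodic {F G : ℝ → ℝ → ℝ}
    (hF : ContDiff ℝ (⊤ : ℕ∞) (Function.uncurry F))
    (hG : ContDiff ℝ (⊤ : ℕ∞) (Function.uncurry G)) (a b c d : ℝ)
    (hper : ∀ s, G s d = G s c) :
    ∫ θ in c..d, ∫ s in a..b, (partialFst F s θ + partialSnd G s θ) =
      ∫ θ in c..d, (F b θ - F a θ) := by
  have hF' : ContDiff ℝ (⊤ : ℕ∞) (Function.uncurry fun θ s => F s θ) :=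
    hF.comp (contDiff_snd.prodMk contDiff_fst)
  have hG' : ContDiff ℝ (⊤ : ℕ∞) (Function.uncurry fun θ s => G s θ) :=
    hG.comp (contDiff_snd.prodMk contDiff_fst)
  have hFd := hF'.differentiable (by simp)
  have hGd := hG'.differentiable (by simp)
  have key := integral2_divergence_prod_of_hasFDerivAt_off_countable
    (Function.uncurry fun θ s => G s θ) (Function.uncurry fun θ s => F s θ)
    _ _ c a d b ∅ countable_empty hG'.continuous.continuousOn hF'.continuous.continuousOn
    (fun p _ => (hGd p).hasFDerivAt) (fun p _ => (hFd p).hasFDerivAt)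
    (ContinuousOn.integrableOn_compact (isCompact_uIcc.prod isCompact_uIcc)
      (Continuous.continuousOn
        (((hG'.continuous_fderiv (by simp)).clm_apply continuous_const).add
          ((hF'.continuous_fderiv (by simp)).clm_apply continuous_const))))
  have hcF : ∀ s, Continuous fun θ => F s θ := fun s =>
    hF.continuous.comp (continuous_const.prodMk continuous_id)
  rw [intervalIntegral.integral_sub ((hcF b).intervalIntegrable _ _)
    ((hcF a).intervalIntegrable _ _)]
  simp only [Function.uncurry_apply_pair, hper, add_sub_cancel_right] at key
  rw [← key]
  refine intervalIntegral.integral_congr fun θ _ =>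
    intervalIntegral.integral_congr fun s _ => ?_
  rw [add_comm]
  congr 1
  · exact (hasDerivAt_fst_fderiv (hGd (θ, s))).deriv
  · exact (hasDerivAt_snd_fderiv (hFd (θ, s))).deriv

/-- Green's first identity on a rectangle for functions periodic in the second variable. -/
theorem integral_green_of_periodic {u w : ℝ → ℝ → ℝ}
    (hu : ContDiff ℝ (⊤ : ℕ∞) (Function.uncurry u))
    (hw : ContDiff ℝ (⊤ : ℕ∞) (Function.uncurry w)) (a b c d : ℝ)
    (hup : ∀ s, partialSnd u s d = partialSnd u s c) (hwp : ∀ s, w s d = w s c) :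
    ∫ θ in c..d, ∫ s in a..b,
        (partialFst u s θ * partialFst w s θ + partialSnd u s θ * partialSnd w s θ
          + planeLaplacian u s θ * w s θ) =
      ∫ θ in c..d, (partialFst u b θ * w b θ - partialFst u a θ * w a θ) := by
  rw [← integral_divergence_of_periodic (F := fun s θ => partialFst u s θ * w s θ)
    (G := fun s θ => partialSnd u s θ * w s θ) ((contDiff_partialFst hu).mul hw)
    ((contDiff_partialSnd hu).mul hw) a b c d (fun s => by simp only [hup, hwp])]
  refine intervalIntegral.integral_congr fun θ _ =>
    intervalIntegral.integral_congr fun s _ => ?_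
  have h1 : partialFst (fun s θ => partialFst u s θ * w s θ) s θ = _ :=
    ((hasDerivAt_partialFst (contDiff_partialFst hu) s θ).mul
      (hasDerivAt_partialFst hw s θ)).deriv
  have h2 : partialSnd (fun s θ => partialSnd u s θ * w s θ) s θ = _ :=
    ((hasDerivAt_partialSnd (contDiff_partialSnd hu) s θ).mul
      (hasDerivAt_partialSnd hw s θ)).deriv
  rw [h1, h2, planeLaplacian]
  ring

theorem integral_integral_add_sub {f g h : ℝ → ℝ → ℝ} (hf : Continuous (Function.uncurry f))
    (hg : Continuous (Function.uncurry g)) (hh : Continuous (Function.uncurry h))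
    (a b c d : ℝ) :
    ∫ θ in c..d, ∫ s in a..b, (f s θ + g s θ - h s θ) =
      (∫ θ in c..d, ∫ s in a..b, f s θ) + (∫ θ in c..d, ∫ s in a..b, g s θ)
        - ∫ θ in c..d, ∫ s in a..b, h s θ := by
  have inner : ∀ {k : ℝ → ℝ → ℝ}, Continuous (Function.uncurry k) → ∀ θ,
      IntervalIntegrable (fun s => k s θ) volume a b := fun hk θ =>
    (hk.comp (continuous_id.prodMk continuous_const)).intervalIntegrable _ _
  have outer : ∀ {k : ℝ → ℝ → ℝ}, Continuous (Function.uncurry k) →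
      IntervalIntegrable (fun θ => ∫ s in a..b, k s θ) volume c d := fun {k} hk =>
    (intervalIntegral.continuous_parametric_intervalIntegral_of_continuous'
      (f := fun θ s => k s θ) (hk.comp continuous_swap) a b).intervalIntegrable _ _
  rw [← intervalIntegral.integral_add (outer hf) (outer hg),
    ← intervalIntegral.integral_sub ((outer hf).add (outer hg)) (outer hh)]
  refine intervalIntegral.integral_congr fun θ _ => ?_
  rw [← intervalIntegral.integral_add (inner hf θ) (inner hg θ),
    ← intervalIntegral.integral_sub ((inner hf θ).add (inner hg θ)) (inner hh θ)]

/-- Integration by parts for the form `∬ ∇φ·∇w - Vφw` against a potential `ψ` of `gφ` that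
vanishes on the boundary `s = ±T`. -/
theorem integral_form_eq_of_potential {φ ψ w : ℝ → ℝ → ℝ} {V g : ℝ → ℝ}
    (hφ : ContDiff ℝ (⊤ : ℕ∞) (Function.uncurry φ))
    (hψ : ContDiff ℝ (⊤ : ℕ∞) (Function.uncurry ψ))
    (hw : ContDiff ℝ (⊤ : ℕ∞) (Function.uncurry w))
    (hV : Continuous V) (hg : Continuous g) {T κ P : ℝ}
    (hφp : ∀ s θ, φ s (θ + P) = φ s θ) (hψp : ∀ s θ, ψ s (θ + P) = ψ s θ)
    (hwp : ∀ s θ, w s (θ + P) = w s θ)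
    (hφ_eq : ∀ s θ, planeLaplacian φ s θ = -(V s * φ s θ))
    (hψ_eq : ∀ s θ, planeLaplacian ψ s θ = -(V s * ψ s θ) - g s * φ s θ)
    (hψT : ∀ θ, ψ T θ = 0) (hψT' : ∀ θ, ψ (-T) θ = 0)
    (hdT : ∀ θ, partialFst ψ T θ = partialFst φ T θ - κ * φ T θ)
    (hdT' : ∀ θ, partialFst ψ (-T) θ = partialFst φ (-T) θ + κ * φ (-T) θ) :
    (∫ θ in (0:ℝ)..P, ∫ s in (-T)..T,
        (partialFst φ s θ * partialFst w s θ + partialSnd φ s θ * partialSnd w s θ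
          - V s * φ s θ * w s θ))
      - κ * ∫ θ in (0:ℝ)..P, (φ T θ * w T θ + φ (-T) θ * w (-T) θ) =
    -(∫ θ in (0:ℝ)..P, ∫ s in (-T)..T, g s * φ s θ * w s θ)
      + ∫ θ in (0:ℝ)..P, ∫ s in (-T)..T,
        (-(partialFst (partialFst w) s θ) - partialSnd (partialSnd w) s θ - V s * w s θ)
          * ψ s θ := by
  have per : ∀ {u : ℝ → ℝ → ℝ}, (∀ s θ, u s (θ + P) = u s θ) → ∀ s, u s P = u s 0 :=
    fun hu s => by simpa using hu s 0
  have E1 := integral_green_of_periodic hφ hw (-T) T 0 P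
    (per (partialSnd_add_period hφp)) (per hwp)
  have E2 := integral_green_of_periodic hψ hw (-T) T 0 P
    (per (partialSnd_add_period hψp)) (per hwp)
  have E3 := integral_green_of_periodic hw hψ (-T) T 0 P
    (per (partialSnd_add_period hwp)) (per hψp)
  have cφ := hφ.continuous
  have cψ := hψ.continuous
  have cw := hw.continuous
  have cV : Continuous fun p : ℝ × ℝ => V p.1 := hV.comp continuous_fst
  have cg : Continuous fun p : ℝ × ℝ => g p.1 := hg.comp continuous_fst
  have grad : ∀ {u v : ℝ → ℝ → ℝ}, ContDiff ℝ (⊤ : ℕ∞) (Function.uncurry u) →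
      ContDiff ℝ (⊤ : ℕ∞) (Function.uncurry v) → Continuous fun p : ℝ × ℝ =>
        partialFst u p.1 p.2 * partialFst v p.1 p.2
          + partialSnd u p.1 p.2 * partialSnd v p.1 p.2 := fun hu hv =>
    ((contDiff_partialFst hu).continuous.mul (contDiff_partialFst hv).continuous).add
      ((contDiff_partialSnd hu).continuous.mul (contDiff_partialSnd hv).continuous)
  have L1 := integral_integral_add_sub
    (f := fun s θ => partialFst φ s θ * partialFst w s θ + partialSnd φ s θ * partialSnd w s θ
          - V s * φ s θ * w s θ)
    (g := fun s θ => g s * φ s θ * w s θ)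
    (h := fun s θ => (-(partialFst (partialFst w) s θ) - partialSnd (partialSnd w) s θ
          - V s * w s θ) * ψ s θ)
    ((grad hφ hw).sub ((cV.mul cφ).mul cw)) ((cg.mul cφ).mul cw)
    ((((contDiff_partialFst (contDiff_partialFst hw)).continuous.neg.sub
      (contDiff_partialSnd (contDiff_partialSnd hw)).continuous).sub (cV.mul cw)).mul cψ)
    (-T) T 0 P
  have L2 := integral_integral_add_sub
    (f := fun s θ => partialFst φ s θ * partialFst w s θ + partialSnd φ s θ * partialSnd w s θ
          + planeLaplacian φ s θ * w s θ)
    (g := fun s θ => partialFst w s θ * partialFst ψ s θ + partialSnd w s θ * partialSnd ψ s θ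
          + planeLaplacian w s θ * ψ s θ)
    (h := fun s θ => partialFst ψ s θ * partialFst w s θ + partialSnd ψ s θ * partialSnd w s θ
          + planeLaplacian ψ s θ * w s θ)
    ((grad hφ hw).add ((continuous_planeLaplacian hφ).mul cw))
    ((grad hw hψ).add ((continuous_planeLaplacian hw).mul cψ))
    ((grad hψ hw).add ((continuous_planeLaplacian hψ).mul cw)) (-T) T 0 P
  rw [E1, E2, E3] at L2
  have hL : ∀ s θ,
      partialFst φ s θ * partialFst w s θ + partialSnd φ s θ * partialSnd w s θ
          + planeLaplacian φ s θ * w s θ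
        + (partialFst w s θ * partialFst ψ s θ + partialSnd w s θ * partialSnd ψ s θ
          + planeLaplacian w s θ * ψ s θ)
        - (partialFst ψ s θ * partialFst w s θ + partialSnd ψ s θ * partialSnd w s θ
          + planeLaplacian ψ s θ * w s θ) =
      partialFst φ s θ * partialFst w s θ + partialSnd φ s θ * partialSnd w s θ
          - V s * φ s θ * w s θ + g s * φ s θ * w s θ
        - (-(partialFst (partialFst w) s θ) - partialSnd (partialSnd w) s θ
          - V s * w s θ) * ψ s θ := fun s θ => by
    rw [hφ_eq, hψ_eq, planeLaplacian]; ring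
  simp only [hL, hψT, hψT', mul_zero, sub_zero, intervalIntegral.integral_zero, add_zero] at L2
  have slice : ∀ {u : ℝ → ℝ → ℝ}, Continuous (Function.uncurry u) → ∀ s,
      Continuous fun θ => u s θ := fun hu s =>
    hu.comp (continuous_const.prodMk continuous_id)
  have bdry : ∀ {u : ℝ → ℝ → ℝ}, ContDiff ℝ (⊤ : ℕ∞) (Function.uncurry u) →
      IntervalIntegrable
        (fun θ => partialFst u T θ * w T θ - partialFst u (-T) θ * w (-T) θ) volume 0 P :=
    fun hu => Continuous.intervalIntegrable
      (((slice (contDiff_partialFst hu).continuous _).mul (slice cw _)).sub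
        ((slice (contDiff_partialFst hu).continuous _).mul (slice cw _))) _ _
  have hB : (∫ θ in (0:ℝ)..P, (partialFst φ T θ * w T θ - partialFst φ (-T) θ * w (-T) θ))
      - (∫ θ in (0:ℝ)..P, (partialFst ψ T θ * w T θ - partialFst ψ (-T) θ * w (-T) θ))
      = κ * ∫ θ in (0:ℝ)..P, (φ T θ * w T θ + φ (-T) θ * w (-T) θ) := by
    rw [← intervalIntegral.integral_sub (bdry hφ) (bdry hψ),
      ← intervalIntegral.integral_const_mul]
    refine intervalIntegral.integral_congr fun θ _ => ?_
    rw [hdT, hdT']; ring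
  linarith

/-- The profile in `s` of `phiV`, with `A = v₁ cos θ + v₂ sin θ` and `B = v₃`. -/
noncomputable def phiProfile (A B s : ℝ) : ℝ := A / cosh s - B * (sinh s / cosh s)

/-- The derivative of `phiProfile`. -/
noncomputable def phiProfileDeriv (A B s : ℝ) : ℝ :=
  -(A * sinh s / cosh s ^ 2) - B / cosh s ^ 2

/-- The profile in `s` of `psiV`, with `A = v₁ cos θ + v₂ sin θ` and `B = v₃`. -/
noncomputable def psiProfile (a A B s : ℝ) : ℝ :=
  a ^ 2 * (A * cosh s + B * s) * (1 - s * (sinh s / cosh s))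
    + (1 / 2) * (1 - a ^ 2 * (cosh s ^ 2 + s ^ 2)) * phiProfile A B s

/-- The derivative of `psiProfile`. -/
noncomputable def psiProfileDeriv (a A B s : ℝ) : ℝ :=
  a ^ 2 * (A * sinh s + B) * (1 - s * (sinh s / cosh s))
    - a ^ 2 * (A * cosh s + B * s) * (sinh s / cosh s + s / cosh s ^ 2)
    - a ^ 2 * (cosh s * sinh s + s) * phiProfile A B s
    + (1 / 2) * (1 - a ^ 2 * (cosh s ^ 2 + s ^ 2)) * phiProfileDeriv A B s

theorem hasDerivAt_sinh_div_cosh (s : ℝ) :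
    HasDerivAt (fun s => sinh s / cosh s) (1 / cosh s ^ 2) s := by
  refine HasDerivAt.congr_deriv
    ((hasDerivAt_sinh s).div (hasDerivAt_cosh s) (cosh_pos s).ne') ?_
  rw [← cosh_sq_sub_sinh_sq s]; ring

theorem hasDerivAt_phiProfile (A B s : ℝ) :
    HasDerivAt (phiProfile A B) (phiProfileDeriv A B s) s := by
  have hc := (cosh_pos s).ne'
  refine HasDerivAt.congr_deriv
    (((hasDerivAt_const s A).div (hasDerivAt_cosh s) hc).sub
    ((hasDerivAt_sinh_div_cosh s).const_mul B)) ?_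
  rw [phiProfileDeriv]; ring

theorem hasDerivAt_phiProfileDeriv (A B s : ℝ) :
    HasDerivAt (phiProfileDeriv A B) (A / cosh s - 2 / cosh s ^ 2 * phiProfile A B s) s := by
  have hc := (cosh_pos s).ne'
  refine HasDerivAt.congr_deriv
    (((((hasDerivAt_sinh s).const_mul A).div ((hasDerivAt_cosh s).pow 2)
    (pow_ne_zero 2 hc)).neg).sub
    ((hasDerivAt_const s B).div ((hasDerivAt_cosh s).pow 2) (pow_ne_zero 2 hc))) ?_
  have h := sinh_sq s
  rw [phiProfile]
  simp only [Pi.pow_apply]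
  field_simp
  ring_nf
  rw [h]
  ring

theorem hasDerivAt_one_sub_mul_sinh_div_cosh (s : ℝ) :
    HasDerivAt (fun s => 1 - s * (sinh s / cosh s)) (-(sinh s / cosh s + s / cosh s ^ 2)) s := by
  refine HasDerivAt.congr_deriv
    (((hasDerivAt_id s).mul (hasDerivAt_sinh_div_cosh s)).const_sub 1) ?_
  simp only [id]; ring

theorem hasDerivAt_half_one_sub (a s : ℝ) :
    HasDerivAt (fun s => (1 / 2) * (1 - a ^ 2 * (cosh s ^ 2 + s ^ 2)))
      (-(a ^ 2 * (cosh s * sinh s + s))) s := by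
  refine HasDerivAt.congr_deriv
    ((((((hasDerivAt_cosh s).pow 2).add ((hasDerivAt_id s).pow 2)).const_mul
    (a ^ 2)).const_sub 1).const_mul (1 / 2)) ?_
  simp; ring

theorem hasDerivAt_psiProfile (a A B s : ℝ) :
    HasDerivAt (psiProfile a A B) (psiProfileDeriv a A B s) s := by
  refine HasDerivAt.congr_deriv
    ((((((hasDerivAt_cosh s).const_mul A).add ((hasDerivAt_id s).const_mul B)).const_mul
    (a ^ 2)).mul (hasDerivAt_one_sub_mul_sinh_div_cosh s)).add
    ((hasDerivAt_half_one_sub a s).mul (hasDerivAt_phiProfile A B s))) ?_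
  simp [psiProfileDeriv]; ring

theorem hasDerivAt_psiProfileDeriv (a A B s : ℝ) :
    HasDerivAt (psiProfileDeriv a A B)
      (psiProfile a A 0 s - 2 / cosh s ^ 2 * psiProfile a A B s
        - 2 * a ^ 2 * cosh s ^ 2 * phiProfile A B s) s := by
  have hc := (cosh_pos s).ne'
  refine HasDerivAt.congr_deriv
    (((((((hasDerivAt_sinh s).const_mul A).add_const B).const_mul (a ^ 2)).mul
      (hasDerivAt_one_sub_mul_sinh_div_cosh s)).sub
    (((((hasDerivAt_cosh s).const_mul A).add ((hasDerivAt_id s).const_mul B)).const_mul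
      (a ^ 2)).mul ((hasDerivAt_sinh_div_cosh s).add
        ((hasDerivAt_id s).div ((hasDerivAt_cosh s).pow 2) (pow_ne_zero 2 hc))))).sub
    (((((hasDerivAt_cosh s).mul (hasDerivAt_sinh s)).add (hasDerivAt_id s)).const_mul
      (a ^ 2)).mul (hasDerivAt_phiProfile A B s)) |>.add
    ((hasDerivAt_half_one_sub a s).mul (hasDerivAt_phiProfileDeriv A B s))) ?_
  have h3 : sinh s ^ 3 = (cosh s ^ 2 - 1) * sinh s := by rw [← sinh_sq]; ring
  simp [psiProfile, phiProfile, phiProfileDeriv]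
  field_simp
  ring_nf
  simp only [sinh_sq, h3]
  ring

theorem phiV_eq (v₁ v₂ v₃ s θ : ℝ) :
    phiV v₁ v₂ v₃ s θ = phiProfile (v₁ * cos θ + v₂ * sin θ) v₃ s := by
  rw [phiV, phiProfile, tanh_eq_sinh_div_cosh]; ring

theorem psiV_eq (a v₁ v₂ v₃ s θ : ℝ) :
    psiV a v₁ v₂ v₃ s θ = psiProfile a (v₁ * cos θ + v₂ * sin θ) v₃ s := by
  rw [psiV, psiProfile, phiV_eq, tanh_eq_sinh_div_cosh]; ring

theorem contDiff_phiV (v₁ v₂ v₃ : ℝ) :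
    ContDiff ℝ (⊤ : ℕ∞) (Function.uncurry (phiV v₁ v₂ v₃)) := by
  have h : Function.uncurry (phiV v₁ v₂ v₃) = fun p =>
      phiProfile (v₁ * cos p.2 + v₂ * sin p.2) v₃ p.1 := funext fun p => phiV_eq ..
  have hc : ContDiff ℝ (⊤ : ℕ∞) fun p : ℝ × ℝ => cosh p.1 := contDiff_cosh.comp contDiff_fst
  have hs : ContDiff ℝ (⊤ : ℕ∞) fun p : ℝ × ℝ => sinh p.1 := contDiff_sinh.comp contDiff_fst
  have hne : ∀ p : ℝ × ℝ, cosh p.1 ≠ 0 := fun p => (cosh_pos _).ne'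
  rw [h]
  unfold phiProfile
  exact (ContDiff.div (by fun_prop) hc hne).sub (contDiff_const.mul (hs.div hc hne))

theorem contDiff_psiV (a v₁ v₂ v₃ : ℝ) :
    ContDiff ℝ (⊤ : ℕ∞) (Function.uncurry (psiV a v₁ v₂ v₃)) := by
  have hφ := contDiff_phiV v₁ v₂ v₃
  have hc : ContDiff ℝ (⊤ : ℕ∞) fun p : ℝ × ℝ => cosh p.1 := contDiff_cosh.comp contDiff_fst
  have ht : ContDiff ℝ (⊤ : ℕ∞) fun p : ℝ × ℝ => tanh p.1 := by
    simp only [tanh_eq_sinh_div_cosh]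
    exact (contDiff_sinh.comp contDiff_fst).div hc fun p => (cosh_pos _).ne'
  exact ContDiff.add (by fun_prop) (ContDiff.mul (by fun_prop) hφ)

theorem hasDerivAt_trig_combination (v₁ v₂ θ : ℝ) :
    HasDerivAt (fun θ => v₁ * cos θ + v₂ * sin θ) (v₂ * cos θ + -v₁ * sin θ) θ :=
  (((hasDerivAt_cos θ).const_mul v₁).add ((hasDerivAt_sin θ).const_mul v₂)).congr_deriv
    (by ring)

theorem partialFst_phiV (v₁ v₂ v₃ : ℝ) : partialFst (phiV v₁ v₂ v₃) =
    fun s θ => phiProfileDeriv (v₁ * cos θ + v₂ * sin θ) v₃ s := by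
  funext s θ
  simp only [partialFst, phiV_eq]
  exact (hasDerivAt_phiProfile _ _ s).deriv

theorem partialFst_psiV (a v₁ v₂ v₃ : ℝ) : partialFst (psiV a v₁ v₂ v₃) =
    fun s θ => psiProfileDeriv a (v₁ * cos θ + v₂ * sin θ) v₃ s := by
  funext s θ
  simp only [partialFst, psiV_eq]
  exact (hasDerivAt_psiProfile _ _ _ s).deriv

theorem partialSnd_phiV (v₁ v₂ v₃ : ℝ) :
    partialSnd (phiV v₁ v₂ v₃) = phiV v₂ (-v₁) 0 := by
  funext s θ
  simp only [partialSnd, phiV_eq]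
  refine HasDerivAt.deriv (HasDerivAt.congr_deriv
    (((hasDerivAt_trig_combination v₁ v₂ θ).div_const (cosh s)).sub_const
      (v₃ * (sinh s / cosh s))) ?_)
  rw [phiProfile]; ring

theorem partialSnd_psiV (a v₁ v₂ v₃ : ℝ) :
    partialSnd (psiV a v₁ v₂ v₃) = psiV a v₂ (-v₁) 0 := by
  funext s θ
  simp only [partialSnd, psiV_eq]
  have hA := hasDerivAt_trig_combination v₁ v₂ θ
  refine HasDerivAt.deriv (HasDerivAt.congr_deriv
    (((((hA.mul_const (cosh s)).add_const (v₃ * s)).const_mul (a ^ 2)).mul_const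
      (1 - s * (sinh s / cosh s))).add
      (((hA.div_const (cosh s)).sub_const (v₃ * (sinh s / cosh s))).const_mul
        ((1 / 2) * (1 - a ^ 2 * (cosh s ^ 2 + s ^ 2))))) ?_)
  rw [psiProfile, phiProfile]; ring

theorem planeLaplacian_phiV (v₁ v₂ v₃ s θ : ℝ) :
    planeLaplacian (phiV v₁ v₂ v₃) s θ = -(2 / cosh s ^ 2 * phiV v₁ v₂ v₃ s θ) := by
  rw [planeLaplacian, partialFst_phiV, partialSnd_phiV, partialSnd_phiV]
  have h : partialFst (fun s θ => phiProfileDeriv (v₁ * cos θ + v₂ * sin θ) v₃ s) s θ = _ :=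
    (hasDerivAt_phiProfileDeriv _ _ s).deriv
  rw [h]
  simp only [phiV_eq, phiProfile]
  ring

theorem planeLaplacian_psiV (a v₁ v₂ v₃ s θ : ℝ) :
    planeLaplacian (psiV a v₁ v₂ v₃) s θ =
      -(2 / cosh s ^ 2 * psiV a v₁ v₂ v₃ s θ)
        - 2 * a ^ 2 * cosh s ^ 2 * phiV v₁ v₂ v₃ s θ := by
  rw [planeLaplacian, partialFst_psiV, partialSnd_psiV, partialSnd_psiV]
  have h : partialFst (fun s θ => psiProfileDeriv a (v₁ * cos θ + v₂ * sin θ) v₃ s) s θ = _ :=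
    (hasDerivAt_psiProfileDeriv _ _ _ s).deriv
  rw [h]
  simp only [phiV_eq, psiV_eq, psiProfile, phiProfile]
  ring

theorem mul_sinh_eq_cosh {s : ℝ} (hs : s * tanh s = 1) : s * sinh s = cosh s := by
  rw [tanh_eq_sinh_div_cosh] at hs
  have hc := (cosh_pos s).ne'
  field_simp at hs
  exact hs

theorem cosh_sq_add_sq {s : ℝ} (hs : s * tanh s = 1) :
    cosh s ^ 2 + s ^ 2 = (s * cosh s) ^ 2 := by
  linear_combination (-(s * sinh s) - cosh s) * mul_sinh_eq_cosh hs - s ^ 2 * cosh_sq s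

theorem psiProfile_boundary {a s : ℝ} (hs : s * tanh s = 1) (ha : a ^ 2 * (s * cosh s) ^ 2 = 1)
    (A B : ℝ) : psiProfile a A B s = 0 := by
  rw [psiProfile, cosh_sq_add_sq hs, ha, ← mul_div_assoc, mul_sinh_eq_cosh hs,
    div_self (cosh_pos s).ne']
  ring

theorem psiProfileDeriv_boundary {a s : ℝ} (hs : s * tanh s = 1)
    (ha : a ^ 2 * (s * cosh s) ^ 2 = 1) (A B : ℝ) :
    psiProfileDeriv a A B s = phiProfileDeriv A B s - 1 / s * phiProfile A B s := by
  have hc := (cosh_pos s).ne'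
  have hs0 : s ≠ 0 := left_ne_zero_of_mul_eq_one hs
  have hS : sinh s = cosh s / s := by
    rw [eq_div_iff hs0, mul_comm]; exact mul_sinh_eq_cosh hs
  have ha' : a ^ 2 = 1 / (s * cosh s) ^ 2 := by
    rw [eq_div_iff (by positivity)]; exact ha
  have h := cosh_sq_add_sq hs
  rw [psiProfileDeriv, h, phiProfileDeriv, phiProfile, hS, ha']
  field_simp
  linear_combination
    2 * (-s * (cosh s * A + s * B) - cosh s * (s * A - cosh s * B)) * h

end

/-- The integration-by-parts formula
`Q(v^⊥, W) = -k ∫_Σ (v^⊥, W) + ∫_Σ (JW, (v,x)x + (1/2)(1-|x|²)v)`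
instantiated on the critical catenoid (`k = 2`): for every smooth, `2π`-periodic
(in `θ`) function `w`,
`B(φ_v, w) = -2a² ∬ cosh² s · φ_v w + ∬ (-∂²w/∂s² - ∂²w/∂θ² - 2 cosh⁻² s · w) ψ_v`. -/
theorem integration_by_parts_formula (T a : ℝ) (hT : 0 < T)
    (hTtanh : T * Real.tanh T = 1) (ha : a = 1 / (T * Real.cosh T))
    (v₁ v₂ v₃ : ℝ) (w : ℝ → ℝ → ℝ)
    (hw_smooth : ContDiff ℝ (⊤ : ℕ∞) (Function.uncurry w))
    (hw_per : ∀ s θ : ℝ, w s (θ + 2 * Real.pi) = w s θ) :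
    indexForm T (phiV v₁ v₂ v₃) w
      = -2 * a ^ 2 * (∫ θ in (0:ℝ)..(2 * Real.pi), ∫ s in (-T)..T,
            (Real.cosh s) ^ 2 * phiV v₁ v₂ v₃ s θ * w s θ)
        + ∫ θ in (0:ℝ)..(2 * Real.pi), ∫ s in (-T)..T,
            (-(iteratedDeriv 2 (fun s' => w s' θ) s)
              - iteratedDeriv 2 (fun θ' => w s θ') θ
              - 2 / (Real.cosh s) ^ 2 * w s θ) * psiV a v₁ v₂ v₃ s θ := by
  have hTtanh' : -T * Real.tanh (-T) = 1 := by rw [Real.tanh_neg, neg_mul_neg, hTtanh]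
  have ha2 : a ^ 2 * (T * Real.cosh T) ^ 2 = 1 := by
    have hc := Real.cosh_pos T
    rw [ha]; field_simp
  have ha2' : a ^ 2 * (-T * Real.cosh (-T)) ^ 2 = 1 := by
    rw [Real.cosh_neg, neg_mul, neg_sq, ha2]
  have hcosh : Continuous fun s : ℝ => 2 / Real.cosh s ^ 2 :=
    continuous_const.div (Real.continuous_cosh.pow 2) fun s => pow_ne_zero 2 (Real.cosh_pos s).ne'
  have key := integral_form_eq_of_potential (T := T) (κ := 1 / T) (contDiff_phiV v₁ v₂ v₃)
    (contDiff_psiV a v₁ v₂ v₃) hw_smooth hcosh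
    (g := fun s => 2 * a ^ 2 * Real.cosh s ^ 2) (by fun_prop)
    (fun s θ => by simp only [phiV_eq, Real.cos_add_two_pi, Real.sin_add_two_pi])
    (fun s θ => by simp only [psiV_eq, Real.cos_add_two_pi, Real.sin_add_two_pi])
    hw_per (planeLaplacian_phiV v₁ v₂ v₃) (planeLaplacian_psiV a v₁ v₂ v₃)
    (fun θ => by rw [psiV_eq, psiProfile_boundary hTtanh ha2])
    (fun θ => by rw [psiV_eq, psiProfile_boundary hTtanh' ha2'])
    (fun θ => by
      rw [partialFst_psiV, partialFst_phiV, phiV_eq]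
      exact psiProfileDeriv_boundary hTtanh ha2 _ _)
    (fun θ => by
      rw [partialFst_psiV, partialFst_phiV, phiV_eq]
      exact (psiProfileDeriv_boundary hTtanh' ha2' _ _).trans (by ring))
  simp only [iteratedDeriv_two_fst, iteratedDeriv_two_snd]
  rw [indexForm]
  refine key.trans ?_
  congr 1
  simp only [mul_assoc, intervalIntegral.integral_const_mul]
  ring
end

section
/- There exist two smooth functions u₁, u₂ : [−T,T] → ℝ, linearly independent over ℝ, such that every nonzero linear combination u = c₁u₁ + c₂u₂ satisfies ∫_{−T}^{T}(u'(s)² − 2·cosh(s)^{-2}·u(s)²) ds − (1/T)·(u(T)² + u(−T)²) < −2·a²·∫_{−T}^{T} cosh(s)²·u(s)² ds. -/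
/-- The symmetric bilinear form `∫_{-T}^T (f' g' + p f g) - κ (f(T) g(T) + f(-T) g(-T))` of a
one-dimensional Schrödinger operator with potential `p` and Robin parameter `κ`. -/
noncomputable def robinForm (p : ℝ → ℝ) (κ T : ℝ) (f g : ℝ → ℝ) : ℝ :=
  (∫ s in (-T)..T, (deriv f s * deriv g s + p s * f s * g s)) -
    κ * (f T * g T + f (-T) * g (-T))

theorem robinForm_linearCombination {p f g : ℝ → ℝ} (κ T : ℝ) (hp : Continuous p)
    (hf : ContDiff ℝ 1 f) (hg : ContDiff ℝ 1 g) (c d : ℝ) :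
    robinForm p κ T (fun s => c * f s + d * g s) (fun s => c * f s + d * g s) =
      c ^ 2 * robinForm p κ T f f + 2 * c * d * robinForm p κ T f g +
        d ^ 2 * robinForm p κ T g g := by
  have hf' := hf.continuous_deriv le_rfl
  have hg' := hg.continuous_deriv le_rfl
  have hfc := hf.continuous
  have hgc := hg.continuous
  have hderiv : deriv (fun s => c * f s + d * g s) = fun s => c * deriv f s + d * deriv g s := by
    ext s
    exact (((hf.differentiable one_ne_zero s).hasDerivAt.const_mul c).add
      ((hg.differentiable one_ne_zero s).hasDerivAt.const_mul d)).deriv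
  have hint : ∫ s in (-T)..T, ((c * deriv f s + d * deriv g s) * (c * deriv f s + d * deriv g s) +
        p s * (c * f s + d * g s) * (c * f s + d * g s)) =
      c ^ 2 * (∫ s in (-T)..T, (deriv f s * deriv f s + p s * f s * f s)) +
        2 * c * d * (∫ s in (-T)..T, (deriv f s * deriv g s + p s * f s * g s)) +
        d ^ 2 * (∫ s in (-T)..T, (deriv g s * deriv g s + p s * g s * g s)) := by
    rw [← intervalIntegral.integral_const_mul, ← intervalIntegral.integral_const_mul,
      ← intervalIntegral.integral_const_mul, ← intervalIntegral.integral_add,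
      ← intervalIntegral.integral_add]
    · congr 1
      ext s
      ring
    all_goals exact Continuous.intervalIntegrable (by fun_prop) _ _
  simp only [robinForm, hderiv, hint]
  ring

theorem intervalIntegral_eq_zero_of_odd {f : ℝ → ℝ} (hf : ∀ s, f (-s) = -f s) (T : ℝ) :
    ∫ s in (-T)..T, f s = 0 := by
  have h := intervalIntegral.integral_comp_neg (a := -T) (b := T) f
  simp only [hf, neg_neg, intervalIntegral.integral_neg] at h
  linarith

theorem robinForm_one_odd {p f : ℝ → ℝ} (κ T : ℝ) (hp : ∀ s, p (-s) = p s)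
    (hf : ∀ s, f (-s) = -f s) : robinForm p κ T (fun _ => 1) f = 0 := by
  have h := intervalIntegral_eq_zero_of_odd (f := fun s => p s * f s)
    (fun s => by rw [hp, hf]; ring) T
  simp [robinForm, hf, h]

/-- The potential of the Jacobi operator of a catenoid of scale `a`, shifted by the spectral
parameter `-2`. -/
noncomputable def catenoidPotential (a s : ℝ) : ℝ :=
  2 * a ^ 2 * Real.cosh s ^ 2 - 2 / Real.cosh s ^ 2

theorem continuous_catenoidPotential (a : ℝ) : Continuous (catenoidPotential a) := by
  have h : ∀ s : ℝ, Real.cosh s ^ 2 ≠ 0 := fun s => pow_ne_zero _ (Real.cosh_pos s).ne'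
  unfold catenoidPotential
  fun_prop (disch := exact h _)

theorem hasDerivAt_tanh (s : ℝ) : HasDerivAt Real.tanh (1 / Real.cosh s ^ 2) s := by
  have h := (Real.hasDerivAt_sinh s).div (Real.hasDerivAt_cosh s) (Real.cosh_pos s).ne'
  refine (h.congr_deriv ?_).congr_of_eventuallyEq
    (.of_forall fun x => Real.tanh_eq_sinh_div_cosh x)
  rw [← Real.cosh_sq_sub_sinh_sq s]
  ring

theorem contDiff_tanh {n : WithTop ℕ∞} : ContDiff ℝ n Real.tanh := by
  have h : Real.tanh = fun s => Real.sinh s / Real.cosh s :=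
    funext Real.tanh_eq_sinh_div_cosh
  rw [h]
  exact Real.contDiff_sinh.div Real.contDiff_cosh fun s => (Real.cosh_pos s).ne'

theorem robinForm_eq_of_hasDerivAt {p f g F : ℝ → ℝ} (κ T : ℝ) (hp : Continuous p)
    (hf : ContDiff ℝ 1 f) (hg : ContDiff ℝ 1 g)
    (hF : ∀ s, HasDerivAt F (deriv f s * deriv g s + p s * f s * g s) s) :
    robinForm p κ T f g = F T - F (-T) - κ * (f T * g T + f (-T) * g (-T)) := by
  have hf' := hf.continuous_deriv le_rfl
  have hg' := hg.continuous_deriv le_rfl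
  have hfc := hf.continuous
  have hgc := hg.continuous
  rw [robinForm, intervalIntegral.integral_eq_sub_of_hasDerivAt (fun s _ => hF s)]
  exact Continuous.intervalIntegrable (by fun_prop) _ _

theorem robinForm_catenoid_one_one (a κ T : ℝ) :
    robinForm (catenoidPotential a) κ T (fun _ => 1) (fun _ => 1) =
      2 * (a ^ 2 * (T + Real.sinh T * Real.cosh T) - 2 * Real.tanh T - κ) := by
  rw [robinForm_eq_of_hasDerivAt
    (F := fun s => a ^ 2 * (s + Real.sinh s * Real.cosh s) - 2 * Real.tanh s) κ T
    (continuous_catenoidPotential a) contDiff_const contDiff_const]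
  · simp only [Real.sinh_neg, Real.cosh_neg, Real.tanh_neg]
    ring
  · intro s
    refine ((((hasDerivAt_id s).add ((Real.hasDerivAt_sinh s).mul
      (Real.hasDerivAt_cosh s))).const_mul (a ^ 2)).sub
      ((hasDerivAt_tanh s).const_mul 2)).congr_deriv ?_
    simp only [deriv_const', catenoidPotential]
    linear_combination (-a ^ 2) * Real.cosh_sq_sub_sinh_sq s

theorem robinForm_catenoid_tanh_tanh (a κ T : ℝ) :
    robinForm (catenoidPotential a) κ T Real.tanh Real.tanh =
      2 * (Real.tanh T / Real.cosh T ^ 2 + a ^ 2 * (Real.sinh T * Real.cosh T - T) -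
        κ * Real.tanh T ^ 2) := by
  rw [robinForm_eq_of_hasDerivAt
    (F := fun s => Real.tanh s / Real.cosh s ^ 2 + a ^ 2 * (Real.sinh s * Real.cosh s - s)) κ T
    (continuous_catenoidPotential a) contDiff_tanh contDiff_tanh]
  · simp only [Real.sinh_neg, Real.cosh_neg, Real.tanh_neg]
    ring
  · intro s
    have hc := (Real.cosh_pos s).ne'
    refine (((hasDerivAt_tanh s).div ((Real.hasDerivAt_cosh s).pow 2) (pow_ne_zero 2 hc)).add
      ((((Real.hasDerivAt_sinh s).mul (Real.hasDerivAt_cosh s)).sub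
        (hasDerivAt_id s)).const_mul (a ^ 2))).congr_deriv ?_
    simp only [(hasDerivAt_tanh s).deriv, catenoidPotential, Real.tanh_eq_sinh_div_cosh,
      Pi.pow_apply]
    field_simp
    linear_combination (a ^ 2 * Real.cosh s ^ 5) * Real.cosh_sq_sub_sinh_sq s

theorem robinForm_catenoid_tanh_id (a κ T : ℝ) :
    robinForm (catenoidPotential a) κ T Real.tanh (fun s => s) =
      2 * (T / Real.cosh T ^ 2 + a ^ 2 * (T * (Real.cosh T ^ 2 + Real.sinh T ^ 2) -
        Real.sinh T * Real.cosh T) / 2 - κ * (T * Real.tanh T)) := by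
  rw [robinForm_eq_of_hasDerivAt
    (F := fun s => s / Real.cosh s ^ 2 + a ^ 2 / 2 * (s * (Real.cosh s ^ 2 + Real.sinh s ^ 2) -
        Real.sinh s * Real.cosh s)) κ T
    (continuous_catenoidPotential a) contDiff_tanh contDiff_fun_id]
  · simp only [Real.sinh_neg, Real.cosh_neg, Real.tanh_neg]
    ring
  · intro s
    have hc := (Real.cosh_pos s).ne'
    refine (((hasDerivAt_id s).div ((Real.hasDerivAt_cosh s).pow 2) (pow_ne_zero 2 hc)).add
      ((((hasDerivAt_id s).mul (((Real.hasDerivAt_cosh s).pow 2).add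
        ((Real.hasDerivAt_sinh s).pow 2))).sub
        ((Real.hasDerivAt_sinh s).mul (Real.hasDerivAt_cosh s))).const_mul
          (a ^ 2 / 2))).congr_deriv ?_
    simp only [(hasDerivAt_tanh s).deriv, catenoidPotential, Real.tanh_eq_sinh_div_cosh, deriv_id'',
      id, Pi.add_apply, Pi.pow_apply]
    field_simp
    ring

theorem one_add_sq_div_two_le_cosh (x : ℝ) : 1 + x ^ 2 / 2 ≤ Real.cosh x := by
  wlog hx : 0 ≤ x generalizing x
  · simpa using this (-x) (by linarith)
  have h := Real.cosh_two_mul (x / 2)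
  rw [mul_div_cancel₀ x two_ne_zero, Real.cosh_sq] at h
  have := pow_le_pow_left₀ (by linarith) (Real.self_le_sinh_iff.mpr (by linarith : 0 ≤ x / 2)) 2
  linarith

theorem exists_two_mul_mul_add_sq_mul_neg {b : ℝ} (hb : b ≠ 0) (c : ℝ) :
    ∃ r : ℝ, 2 * r * b + r ^ 2 * c < 0 := by
  have hc : 0 < |c| + 1 := by positivity
  refine ⟨-b / (|c| + 1), ?_⟩
  have h : 2 * (-b / (|c| + 1)) * b + (-b / (|c| + 1)) ^ 2 * c =
      -(b ^ 2 * (2 * |c| + 2 - c) / (|c| + 1) ^ 2) := by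
    field_simp
    ring
  have : 0 < 2 * |c| + 2 - c := by linarith [le_abs_self c, abs_nonneg c]
  rw [h]
  have := sq_pos_of_ne_zero hb
  exact neg_neg_of_pos (by positivity)

/-- A function on the critical catenoid has Rayleigh quotient less than `-2` as soon as the
shifted Robin form is negative on it. -/
theorem index_form_lt_of_robinForm_neg {a T : ℝ} {u : ℝ → ℝ} (hu : ContDiff ℝ 1 u)
    (h : robinForm (catenoidPotential a) (1 / T) T u u < 0) :
    (∫ s in (-T)..T, ((deriv u s) ^ 2 - 2 / (Real.cosh s) ^ 2 * u s ^ 2)) -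
        (1 / T) * (u T ^ 2 + u (-T) ^ 2) <
      -2 * a ^ 2 * ∫ s in (-T)..T, (Real.cosh s) ^ 2 * u s ^ 2 := by
  have hu' := hu.continuous_deriv le_rfl
  have huc := hu.continuous
  have hc : ∀ s : ℝ, Real.cosh s ^ 2 ≠ 0 := fun s => pow_ne_zero _ (Real.cosh_pos s).ne'
  have hint : ∫ s in (-T)..T, (deriv u s * deriv u s + catenoidPotential a s * u s * u s) =
      (∫ s in (-T)..T, ((deriv u s) ^ 2 - 2 / (Real.cosh s) ^ 2 * u s ^ 2)) +
        2 * a ^ 2 * ∫ s in (-T)..T, (Real.cosh s) ^ 2 * u s ^ 2 := by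
    rw [← intervalIntegral.integral_const_mul, ← intervalIntegral.integral_add]
    · congr 1
      ext s
      simp only [catenoidPotential]
      ring
    · exact Continuous.intervalIntegrable (by fun_prop (disch := exact hc _)) _ _
    · exact Continuous.intervalIntegrable (by fun_prop) _ _
  rw [robinForm, hint] at h
  linarith


/-- The radial Robin eigenvalue problem for the Jacobi operator on the critical
catenoid admits two eigenvalues strictly less than `-2`: there exist two smooth,
linearly independent functions `u₁ u₂ : [-T,T] → ℝ` such that every nonzero linear
combination `u` satisfies
`∫_{-T}^T (u'² - 2 cosh⁻² s · u²) ds - (1/T)(u(T)² + u(-T)²)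
  < -2 a² ∫_{-T}^T cosh² s · u² ds`. -/
theorem two_radial_eigenvalues_below_minus_two (T a : ℝ) (hT : 0 < T)
    (hTtanh : T * Real.tanh T = 1) (ha : a = 1 / (T * Real.cosh T)) :
    ∃ u₁ u₂ : ℝ → ℝ,
      ContDiff ℝ (⊤ : ℕ∞) u₁ ∧ ContDiff ℝ (⊤ : ℕ∞) u₂ ∧
      LinearIndependent ℝ ![u₁, u₂] ∧
      (∀ c₁ c₂ : ℝ, ¬(c₁ = 0 ∧ c₂ = 0) →
        (∫ s in (-T)..T,
            ((deriv (fun s' => c₁ * u₁ s' + c₂ * u₂ s') s) ^ 2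
              - 2 / (Real.cosh s) ^ 2 * (c₁ * u₁ s + c₂ * u₂ s) ^ 2))
          - (1 / T) * ((c₁ * u₁ T + c₂ * u₂ T) ^ 2 + (c₁ * u₁ (-T) + c₂ * u₂ (-T)) ^ 2)
          < -2 * a ^ 2 * ∫ s in (-T)..T,
              (Real.cosh s) ^ 2 * (c₁ * u₁ s + c₂ * u₂ s) ^ 2) := by
  have hc := Real.cosh_pos T
  have hT0 := hT.ne'
  have hcs := Real.cosh_sq_sub_sinh_sq T
  have htanh : Real.tanh T = 1 / T := by
    field_simp
    linarith
  have hsinh : Real.cosh T = T * Real.sinh T := by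
    rw [Real.tanh_eq_sinh_div_cosh] at hTtanh
    field_simp at hTtanh
    exact hTtanh.symm
  have hs : 0 < Real.sinh T := Real.sinh_pos_iff.mpr hT
  have hs2 : Real.sinh T ^ 2 * (T ^ 2 - 1) = 1 := by
    rw [hsinh] at hcs
    linear_combination hcs
  have hT1 : T ^ 2 - 1 ≠ 0 := right_ne_zero_of_mul (hs2.trans_ne one_ne_zero)
  have hT2 : T ^ 2 ≠ 3 / 2 := by
    intro h
    have hle := one_add_sq_div_two_le_cosh T
    have hcosh : Real.cosh T ^ 2 = 3 := by
      rw [hsinh]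
      rw [h] at hs2
      linear_combination (Real.sinh T ^ 2) * h + 3 * hs2
    nlinarith
  have hs2' : Real.sinh T ^ 2 = 1 / (T ^ 2 - 1) := eq_div_of_mul_eq hT1 hs2
  have h11 : robinForm (catenoidPotential a) (1 / T) T (fun _ => 1) (fun _ => 1) = -4 / T := by
    rw [robinForm_catenoid_one_one, ha, htanh, hsinh]
    field_simp
    rw [hs2']
    field_simp
    ring
  have htt : robinForm (catenoidPotential a) (1 / T) T Real.tanh Real.tanh = 0 := by
    rw [robinForm_catenoid_tanh_tanh, ha, htanh, hsinh]
    field_simp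
    rw [hs2']
    field_simp
    ring
  have hti : robinForm (catenoidPotential a) (1 / T) T Real.tanh (fun s => s) ≠ 0 := by
    have h : robinForm (catenoidPotential a) (1 / T) T Real.tanh (fun s => s) =
        2 * (T ^ 2 - 3 / 2) / T := by
      rw [robinForm_catenoid_tanh_id, ha, htanh, hsinh]
      field_simp
      rw [hs2']
      field_simp
      ring
    rw [h]
    exact div_ne_zero (mul_ne_zero two_ne_zero (sub_ne_zero.mpr hT2)) hT0
  obtain ⟨r, hr⟩ := exists_two_mul_mul_add_sq_mul_neg hti
    (robinForm (catenoidPotential a) (1 / T) T (fun s => s) (fun s => s))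
  set v : ℝ → ℝ := fun s => 1 * Real.tanh s + r * s with hv
  have hvv : robinForm (catenoidPotential a) (1 / T) T v v < 0 := by
    rw [hv, robinForm_linearCombination _ _ (continuous_catenoidPotential a) contDiff_tanh
      contDiff_fun_id, htt]
    linarith
  have hv_smooth : ∀ {n : WithTop ℕ∞}, ContDiff ℝ n v := fun {n} =>
    (contDiff_const.mul contDiff_tanh).add (contDiff_const.mul contDiff_id)
  have h1v : robinForm (catenoidPotential a) (1 / T) T (fun _ => 1) v = 0 :=
    robinForm_one_odd _ _ (fun s => by simp [catenoidPotential])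
      (fun s => by simp only [hv, Real.tanh_neg]; ring)
  have key : ∀ c₁ c₂ : ℝ, ¬(c₁ = 0 ∧ c₂ = 0) →
      (∫ s in (-T)..T,
          ((deriv (fun s' => c₁ * (fun _ => (1 : ℝ)) s' + c₂ * v s') s) ^ 2
            - 2 / (Real.cosh s) ^ 2 * (c₁ * (fun _ => (1 : ℝ)) s + c₂ * v s) ^ 2))
        - (1 / T) * ((c₁ * (fun _ => (1 : ℝ)) T + c₂ * v T) ^ 2
          + (c₁ * (fun _ => (1 : ℝ)) (-T) + c₂ * v (-T)) ^ 2)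
        < -2 * a ^ 2 * ∫ s in (-T)..T,
            (Real.cosh s) ^ 2 * (c₁ * (fun _ => (1 : ℝ)) s + c₂ * v s) ^ 2 := by
    intro c₁ c₂ hne
    refine index_form_lt_of_robinForm_neg
      ((contDiff_const.mul contDiff_const).add (contDiff_const.mul hv_smooth)) ?_
    rw [robinForm_linearCombination _ _ (continuous_catenoidPotential a) contDiff_const hv_smooth,
      h1v, h11]
    have h4 : -4 / T < 0 := div_neg_of_neg_of_pos (by norm_num) hT
    rcases eq_or_ne c₁ 0 with rfl | h₁
    · have := sq_pos_of_ne_zero (fun h => hne ⟨rfl, h⟩ : c₂ ≠ 0)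
      nlinarith
    · have := sq_pos_of_ne_zero h₁
      nlinarith [sq_nonneg c₂]
  refine ⟨fun _ => 1, v, contDiff_const, hv_smooth, ?_, key⟩
  rw [LinearIndependent.pair_iff]
  intro c₁ c₂ h
  by_contra hne
  have hzero : ∀ s, c₁ * (1 : ℝ) + c₂ * v s = 0 := fun s => congrFun h s
  have := key c₁ c₂ hne
  simp only [hzero] at this
  simp at this
end
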